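/- arXiv:2605.08859 — 2 statements merged into one kernel-verified Lean document; each statement's English description precedes it below -/
import Mathlib

section
/- Let α ∈ [1/4, 3/11], let τ ∈ [0, α), and let n ≥ 1 be an integer. For m ∈ {n, 2n} define the sequence γ_m : ℕ → ℝ by γ_m(1) = 1 and γ_m(i+1) = (1 − (1−α)/(2(γ_m(i) − τ − α)·m))·γ_m(i) for i ≥ 1. Suppose that for some integers k, l ≥ 1 we have γ_n(k) ≥ β, where β = γ_{2n}(l) and β > α + τ + (1 − α + √(16n(α+τ)(1−α) + (1−α)²))/(8n). Then γ_{2n}(l+2) ≤ γ_n(k+1). -/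
/-- The recursively defined sequence: `γ_m 1 = 1` and
`γ_m (i+1) = (1 - (1-α)/(2(γ_m i - τ - α)·m))·γ_m i` for `i ≥ 1`. -/
noncomputable def gam (α τ : ℝ) (m : ℕ) : ℕ → ℝ
  | 0 => 1
  | 1 => 1
  | i + 2 => (1 - (1 - α) / (2 * (gam α τ m (i + 1) - τ - α) * m)) * gam α τ m (i + 1)

theorem gam_step (α τ : ℝ) (m i : ℕ) (hi : 1 ≤ i) : gam α τ m (i + 1) =
    (1 - (1 - α) / (2 * (gam α τ m i - τ - α) * m)) * gam α τ m i := by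
  obtain ⟨j, rfl⟩ : ∃ j, i = j + 1 := ⟨i - 1, by omega⟩
  rfl

/-- Doubling inequality: if `γ_n(k) ≥ β = γ_{2n}(l)` and `β` exceeds the stated
threshold, then `γ_{2n}(l+2) ≤ γ_n(k+1)`. -/
theorem gam_doubling (α τ : ℝ) (hα1 : 1 / 4 ≤ α) (hα2 : α ≤ 3 / 11)
    (hτ0 : 0 ≤ τ) (hτ : τ < α)
    (n : ℕ) (hn : 1 ≤ n) (k l : ℕ) (hk : 1 ≤ k) (hl : 1 ≤ l)
    (hkl : gam α τ (2 * n) l ≤ gam α τ n k)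
    (hβ : α + τ + (1 - α + Real.sqrt (16 * n * (α + τ) * (1 - α) + (1 - α) ^ 2)) / (8 * n)
      < gam α τ (2 * n) l) :
    gam α τ (2 * n) (l + 2) ≤ gam α τ n (k + 1) := by
  have hN : (0 : ℝ) < n := by exact_mod_cast hn
  rw [show l + 2 = (l + 1) + 1 from rfl, gam_step α τ (2 * n) (l + 1) (by omega),
    gam_step α τ (2 * n) l hl, gam_step α τ n k hk]
  generalize gam α τ (2 * n) l = b at *
  generalize gam α τ n k = g at *
  push_cast
  generalize (n : ℝ) = N at *
  obtain ⟨p, hp⟩ : ∃ p, p = 1 - α := ⟨_, rfl⟩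
  obtain ⟨s, hs⟩ : ∃ s, s = α + τ := ⟨_, rfl⟩
  rw [← hp, ← hs] at hβ
  rw [← hp]
  have hp0 : 0 < p := by linarith
  have hs0 : 0 < s := by linarith
  set D := Real.sqrt (16 * N * s * p + p ^ 2) with hD
  have hD0 : 0 ≤ D := Real.sqrt_nonneg _
  have hD2 : D ^ 2 = 16 * N * s * p + p ^ 2 := Real.sq_sqrt (by positivity)
  obtain ⟨y, hy⟩ : ∃ y, y = b - s := ⟨_, rfl⟩
  have h1 : p + D < 8 * N * y := by
    have : (p + D) / (8 * N) < y := by linarith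
    rw [div_lt_iff₀ (by positivity)] at this
    linarith
  have hy0 : 0 < y := by
    by_contra h
    have : N * y ≤ 0 := mul_nonpos_of_nonneg_of_nonpos hN.le (not_lt.mp h)
    linarith
  have h2 : p * (y + s) < 4 * N * y ^ 2 := by
    have h3 : D ^ 2 < (8 * N * y - p) ^ 2 := by
      apply pow_lt_pow_left₀ (by linarith) hD0 (by norm_num)
    have h4 : 16 * N * (p * (y + s)) < 16 * N * (4 * N * y ^ 2) := by nlinarith
    exact lt_of_mul_lt_mul_left h4 (by positivity)
  obtain ⟨z, hz⟩ : ∃ z, z = g - s := ⟨_, rfl⟩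
  have hyz : y ≤ z := by linarith
  have hz0 : 0 < z := by linarith
  have eb : b - τ - α = y := by linarith
  have eg : g - τ - α = z := by linarith
  have eb' : b = y + s := by linarith
  have eg' : g = z + s := by linarith
  rw [eb, eg, eb', eg']
  obtain ⟨w, hw⟩ : ∃ w, w = (1 - p / (2 * y * (2 * N))) * (y + s) - s := ⟨_, rfl⟩
  have hw1 : w = y - p * (y + s) / (4 * N * y) := by rw [hw]; field_simp; ring
  have hw0 : 0 < w := by
    rw [hw1, sub_pos, div_lt_iff₀ (by positivity)]
    linarith
  have hwy : w ≤ y := by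
    have : 0 ≤ p * (y + s) / (4 * N * y) := by positivity
    linarith
  have e1 : (1 - p / (2 * y * (2 * N))) * (y + s) = w + s := by linarith
  rw [e1, show w + s - τ - α = w by linarith]
  have e2 : (1 - p / (2 * w * (2 * N))) * (w + s) = w + s - p / (4 * N) - p * s / (4 * N) / w := by
    field_simp; ring
  have e3 : (1 - p / (2 * z * N)) * (z + s) = z + s - p / (2 * N) - p * s / (2 * N) / z := by
    field_simp; ring
  have e4 : w = y - p / (4 * N) - p * s / (4 * N) / y := by rw [hw1]; field_simp; ring
  have i1 : p * s / (4 * N) / y ≤ p * s / (4 * N) / w := by gcongr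
  have i2 : p * s / (2 * N) / z ≤ p * s / (2 * N) / y := by gcongr
  have e5 : p * s / (2 * N) / y = 2 * (p * s / (4 * N) / y) := by field_simp; ring
  have e6 : p / (2 * N) = 2 * (p / (4 * N)) := by field_simp; ring
  rw [e2, e3]
  linarith
end

section
/- Let α ∈ [3/11, 1/3), let τ ∈ [0, α), and let n ≥ 1 be an integer. For m ∈ {n, 2n} define the sequence γ_m : ℕ → ℝ by γ_m(1) = 1 and, for k ≥ 1: if γ_m(k) − τ ≥ 3α then γ_m(k+1) = (1 − 2(1−3α)/((γ_m(k) − τ − 12α + 3)·m))·γ_m(k), and if γ_m(k) − τ < 3α then γ_m(k+1) = (1 − 4α/(3(γ_m(k) − τ − α)·m))·γ_m(k). Suppose that for some integers k, l ≥ 1 we have γ_n(k) ≥ β, where β = γ_{2n}(l) and β > α + τ + (α + √(6(α+τ)·α·n + α²))/(3n). Then γ_{2n}(l+2) ≤ γ_n(k+1). -/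
/-- The two-regime recursively defined sequence: `γ_m 1 = 1` and, for `k ≥ 1`,
if `γ_m k - τ ≥ 3α` then `γ_m (k+1) = (1 - 2(1-3α)/((γ_m k - τ - 12α + 3)·m))·γ_m k`,
and if `γ_m k - τ < 3α` then `γ_m (k+1) = (1 - 4α/(3(γ_m k - τ - α)·m))·γ_m k`. -/
noncomputable def gam2 (α τ : ℝ) (m : ℕ) : ℕ → ℝ
  | 0 => 1
  | 1 => 1
  | i + 2 =>
      if 3 * α ≤ gam2 α τ m (i + 1) - τ then
        (1 - 2 * (1 - 3 * α) / ((gam2 α τ m (i + 1) - τ - 12 * α + 3) * m)) *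
          gam2 α τ m (i + 1)
      else
        (1 - 4 * α / (3 * (gam2 α τ m (i + 1) - τ - α) * m)) * gam2 α τ m (i + 1)

/-- The decrement of one step, multiplied by `m`. -/
noncomputable def stepH (α τ x : ℝ) : ℝ :=
  if 3 * α ≤ x - τ then 2 * (1 - 3 * α) * x / (x - τ - 12 * α + 3)
  else 4 * α * x / (3 * (x - τ - α))

theorem gam2_step (α τ : ℝ) (m k : ℕ) (hk : 1 ≤ k) :
    gam2 α τ m (k + 1) = gam2 α τ m k - stepH α τ (gam2 α τ m k) / m := by
  obtain ⟨i, rfl⟩ : ∃ i, k = i + 1 := ⟨k - 1, by omega⟩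
  rw [show i + 1 + 1 = i + 2 from rfl, gam2]
  unfold stepH
  split_ifs
  · rw [← div_div]; ring
  · rw [← div_div]; ring

theorem stepH_high (α τ x : ℝ) (hα1 : 3 / 11 ≤ α) (hα2 : α < 1 / 3)
    (hτ0 : 0 ≤ τ) (hx : 3 * α ≤ x - τ) :
    stepH α τ x ≤ 2 / 3 * (3 * α + τ) := by
  unfold stepH
  rw [if_pos hx, div_le_iff₀ (by linarith)]
  nlinarith [mul_nonneg (sub_nonneg.2 hx) (by linarith : 0 ≤ 12 * α + τ - 3)]

theorem stepH_low (α τ x : ℝ) (hα1 : 3 / 11 ≤ α)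
    (hτ0 : 0 ≤ τ) (hx : ¬ 3 * α ≤ x - τ) (hx' : α + τ < x) :
    2 / 3 * (3 * α + τ) ≤ stepH α τ x := by
  unfold stepH
  push Not at hx
  rw [if_neg (not_le.2 hx), le_div_iff₀ (by linarith)]
  nlinarith [mul_nonneg (sub_nonneg.2 hx.le) (by linarith : 0 ≤ α + τ)]

theorem stepH_anti (α τ x y : ℝ) (hα1 : 3 / 11 ≤ α) (hα2 : α < 1 / 3)
    (hτ0 : 0 ≤ τ) (hx : α + τ < x) (hxy : x ≤ y) :
    stepH α τ y ≤ stepH α τ x := by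
  by_cases h1 : 3 * α ≤ x - τ
  · have h2 : 3 * α ≤ y - τ := by linarith
    unfold stepH
    rw [if_pos h1, if_pos h2, div_le_div_iff₀ (by linarith) (by linarith)]
    have key : y * (x - τ - 12 * α + 3) ≤ x * (y - τ - 12 * α + 3) := by
      nlinarith [mul_nonneg (sub_nonneg.2 hxy) (by linarith : 0 ≤ 12 * α + τ - 3)]
    have := mul_le_mul_of_nonneg_left key (by linarith : 0 ≤ 2 * (1 - 3 * α))
    linarith
  · by_cases h2 : 3 * α ≤ y - τ
    · exact (stepH_high α τ y hα1 hα2 hτ0 h2).trans (stepH_low α τ x hα1 hτ0 h1 hx)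
    · unfold stepH
      rw [if_neg h1, if_neg h2, div_le_div_iff₀ (by linarith) (by linarith)]
      have key : y * (x - τ - α) ≤ x * (y - τ - α) := by
        nlinarith [mul_nonneg (sub_nonneg.2 hxy) (by linarith : 0 ≤ α + τ)]
      have := mul_le_mul_of_nonneg_left key (by linarith : 0 ≤ 12 * α)
      linarith

theorem stepH_nonneg (α τ x : ℝ) (hα1 : 3 / 11 ≤ α) (hα2 : α < 1 / 3)
    (hτ0 : 0 ≤ τ) (hx : α + τ < x) : 0 ≤ stepH α τ x := by
  unfold stepH
  split_ifs with h
  · exact div_nonneg (mul_nonneg (by linarith) (by linarith)) (by linarith)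
  · exact div_nonneg (mul_nonneg (by linarith) (by linarith)) (by linarith)

theorem next_gt (α τ b N : ℝ) (hα1 : 3 / 11 ≤ α) (hα2 : α < 1 / 3)
    (hτ0 : 0 ≤ τ) (hτ : τ < α) (hN : 1 ≤ N)
    (hβ : α + τ + (α + Real.sqrt (6 * (α + τ) * α * N + α ^ 2)) / (3 * N) < b) :
    α + τ < b - stepH α τ b / (2 * N) := by
  have hs := Real.sqrt_nonneg (6 * (α + τ) * α * N + α ^ 2)
  have hs2 := Real.sq_sqrt (show 0 ≤ 6 * (α + τ) * α * N + α ^ 2 by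
    have : 0 ≤ α := by linarith
    positivity)
  set s := Real.sqrt (6 * (α + τ) * α * N + α ^ 2)
  have hlt : (α + s) / (3 * N) < b - (α + τ) := by linarith
  rw [div_lt_iff₀ (by linarith)] at hlt
  have hy : 0 < b - (α + τ) := by
    by_contra hc
    push Not at hc
    nlinarith
  have hgoal : stepH α τ b / (2 * N) < b - (α + τ) → α + τ < b - stepH α τ b / (2 * N) := by
    intro h; linarith
  apply hgoal
  rw [div_lt_iff₀ (by linarith)]
  by_cases h : 3 * α ≤ b - τ
  · have := stepH_high α τ b hα1 hα2 hτ0 h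
    nlinarith
  · unfold stepH
    rw [if_neg h, div_lt_iff₀ (by linarith)]
    have h3 : s ^ 2 < ((b - (α + τ)) * (3 * N) - α) ^ 2 := by
      apply pow_lt_pow_left₀ (by linarith) hs (by norm_num)
    rw [hs2] at h3
    have h4 : N * (4 * α * b) < N * ((b - (α + τ)) * (2 * N) * (3 * (b - τ - α))) := by
      nlinarith
    exact lt_of_mul_lt_mul_left h4 (by linarith)

/-- Doubling inequality for the two-regime sequence: if `γ_n(k) ≥ β = γ_{2n}(l)` and
`β` exceeds the stated threshold, then `γ_{2n}(l+2) ≤ γ_n(k+1)`. -/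
theorem gam2_doubling (α τ : ℝ) (hα1 : 3 / 11 ≤ α) (hα2 : α < 1 / 3)
    (hτ0 : 0 ≤ τ) (hτ : τ < α)
    (n : ℕ) (hn : 1 ≤ n) (k l : ℕ) (hk : 1 ≤ k) (hl : 1 ≤ l)
    (hkl : gam2 α τ (2 * n) l ≤ gam2 α τ n k)
    (hβ : α + τ + (α + Real.sqrt (6 * (α + τ) * α * n + α ^ 2)) / (3 * n)
      < gam2 α τ (2 * n) l) :
    gam2 α τ (2 * n) (l + 2) ≤ gam2 α τ n (k + 1) := by
  have hN : (1 : ℝ) ≤ n := by exact_mod_cast hn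
  have hx1 := next_gt α τ _ n hα1 hα2 hτ0 hτ hN hβ
  have hb : α + τ < gam2 α τ (2 * n) l := by
    have : 0 ≤ (α + Real.sqrt (6 * (α + τ) * α * n + α ^ 2)) / (3 * n) :=
      div_nonneg (add_nonneg (by linarith) (Real.sqrt_nonneg _)) (by linarith)
    linarith
  rw [show l + 2 = (l + 1) + 1 from rfl, gam2_step α τ (2 * n) (l + 1) (by omega),
    gam2_step α τ n k hk, gam2_step α τ (2 * n) l hl]
  push_cast
  generalize gam2 α τ (2 * n) l = b at *
  generalize gam2 α τ n k = c at *
  have h0 := stepH_nonneg α τ b hα1 hα2 hτ0 hb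
  have h1 : b - stepH α τ b / (2 * n) ≤ b := by
    have : 0 ≤ stepH α τ b / (2 * n) := by positivity
    linarith
  have h2 := stepH_anti α τ _ _ hα1 hα2 hτ0 hx1 h1
  have h3 := stepH_anti α τ b c hα1 hα2 hτ0 hb hkl
  have h4 : stepH α τ b / (2 * n) ≤ stepH α τ (b - stepH α τ b / (2 * n)) / (2 * n) := by
    gcongr
  have h5 : stepH α τ c / n ≤ stepH α τ b / n := by gcongr
  have h6 : stepH α τ b / n = stepH α τ b / (2 * n) + stepH α τ b / (2 * n) := by
    field_simp; norm_num
  linarith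
end
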